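/- Fix β ∈ ℝ and smooth a, b : ℝ → ℝ, set δ(y) = (3/8)β a(y)² and φ(ρ,y) = ρ + δ(y) ln ρ + b(y). Then for all ρ > 0 and y ∈ ℝ: Ψ(a cos φ)(ρ,y) = (−δ(y)²/ρ² + 1/(4ρ²)) a(y) cos φ + (δ(y)/ρ²) a(y) sin φ + (2δ(y)/(3ρ)) a(y) cos 3φ − ρ^{-2} ∂_y²( a(y) cos φ(ρ,y) ), where Ψ(V) = ∂_ρ²V + (1 + (β/ρ)V² + 1/(4ρ²))V − ρ^{-2}∂_y²V. Moreover ∂_y²(a cos φ)(ρ,y) can be written as Σ_{j=0}^{2} ( a_j(y) cos φ + b_j(y) sin φ ) ln^j ρ for smooth functions a_j, b_j built from a, b and their first two derivatives. -/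

import Mathlib

open Real

/-- The cubic Klein–Gordon operator in hyperbolic coordinates acting on
`V = ρ^{1/2}v`: `Ψ(V) = ∂_ρ²V + (1 + (β/ρ)V² + 1/(4ρ²))V − ρ^{-2}∂_y²V`. -/
noncomputable def Psi (β : ℝ) (V : ℝ → ℝ → ℝ) (ρ y : ℝ) : ℝ :=
  deriv (deriv (fun r => V r y)) ρ
    + (1 + β / ρ * (V ρ y) ^ 2 + 1 / (4 * ρ ^ 2)) * V ρ y
    - 1 / ρ ^ 2 * deriv (deriv (fun z => V ρ z)) y

/-- Second derivative of an amplitude-phase product `f cos θ`. -/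
theorem deriv_deriv_mul_cos {f f' θ θ' : ℝ → ℝ} {f'' θ'' x : ℝ}
    (hf : ∀ᶠ z in nhds x, HasDerivAt f (f' z) z) (hθ : ∀ᶠ z in nhds x, HasDerivAt θ (θ' z) z)
    (hf' : HasDerivAt f' f'' x) (hθ' : HasDerivAt θ' θ'' x) :
    deriv (deriv (fun z => f z * Real.cos (θ z))) x =
      (f'' - f x * θ' x ^ 2) * Real.cos (θ x) - (2 * f' x * θ' x + f x * θ'') * Real.sin (θ x) := by
  have first : deriv (fun z => f z * Real.cos (θ z)) =ᶠ[nhds x]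
      fun z => f' z * Real.cos (θ z) + f z * (-Real.sin (θ z) * θ' z) := by
    filter_upwards [hf, hθ] with z hfz hθz
    exact (hfz.mul hθz.cos).deriv
  have hfx := hf.self_of_nhds
  have hθx := hθ.self_of_nhds
  rw [first.deriv_eq]
  refine ((hf'.mul hθx.cos).add (hfx.mul (hθx.sin.neg.mul hθ'))).deriv.trans ?_
  simp only [Pi.neg_apply, Pi.mul_apply]
  ring

/-- Residual of the zeroth order ansatz `V₀ = a(y) cos φ`, `φ = ρ + δ(y) log ρ + b(y)`,
`δ(y) = (3/8)βa(y)²`: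
`Ψ(a cos φ) = (−δ²/ρ² + 1/(4ρ²)) a cos φ + (δ/ρ²) a sin φ + (2δ/(3ρ)) a cos 3φ
 − ρ^{-2}∂_y²(a cos φ)`, and `∂_y²(a cos φ)` is a combination
`Σ_{j≤2} (a_j(y) cos φ + b_j(y) sin φ) ln^j ρ`. -/
theorem residual_of_zeroth_ansatz (β : ℝ) (a b : ℝ → ℝ)
    (ha : ContDiff ℝ (⊤ : ℕ∞) a) (hb : ContDiff ℝ (⊤ : ℕ∞) b)
    (δ : ℝ → ℝ) (hδ : ∀ y, δ y = (3 / 8) * β * (a y) ^ 2)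
    (φ : ℝ → ℝ → ℝ) (hφ : ∀ ρ y, φ ρ y = ρ + δ y * Real.log ρ + b y) :
    (∀ ρ : ℝ, 0 < ρ → ∀ y : ℝ,
      Psi β (fun r z => a z * Real.cos (φ r z)) ρ y =
        (-(δ y) ^ 2 / ρ ^ 2 + 1 / (4 * ρ ^ 2)) * a y * Real.cos (φ ρ y)
        + δ y / ρ ^ 2 * a y * Real.sin (φ ρ y)
        + 2 * δ y / (3 * ρ) * a y * Real.cos (3 * φ ρ y)
        - 1 / ρ ^ 2 * deriv (deriv (fun z => a z * Real.cos (φ ρ z))) y) ∧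
    (∃ A B : ℕ → ℝ → ℝ,
      (∀ j : ℕ, ContDiff ℝ (⊤ : ℕ∞) (A j) ∧ ContDiff ℝ (⊤ : ℕ∞) (B j)) ∧
      ∀ ρ : ℝ, 0 < ρ → ∀ y : ℝ,
        deriv (deriv (fun z => a z * Real.cos (φ ρ z))) y =
          ∑ j ∈ Finset.range 3,
            (A j y * Real.cos (φ ρ y) + B j y * Real.sin (φ ρ y)) * (Real.log ρ) ^ j) := by
  have smooth_deriv {f : ℝ → ℝ} (hf : ContDiff ℝ (⊤ : ℕ∞) f) : ContDiff ℝ (⊤ : ℕ∞) (deriv f) :=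
    (contDiff_infty_iff_deriv.mp hf).2
  have hasDeriv {f : ℝ → ℝ} (hf : ContDiff ℝ (⊤ : ℕ∞) f) (z : ℝ) : HasDerivAt f (deriv f z) z :=
    (contDiff_infty_iff_deriv.mp hf).1.differentiableAt.hasDerivAt
  have smooth_δ : ContDiff ℝ (⊤ : ℕ∞) δ := by
    rw [funext hδ]
    fun_prop
  have ha' := smooth_deriv ha
  have hb' := smooth_deriv hb
  have hδ' := smooth_deriv smooth_δ
  have ha'' := smooth_deriv ha'
  have hb'' := smooth_deriv hb'
  have hδ'' := smooth_deriv hδ'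
  constructor
  · intro ρ hρ y
    have hφ_deriv : ∀ᶠ r in nhds ρ, HasDerivAt (fun r => φ r y) (1 + δ y * r⁻¹) r := by
      filter_upwards [lt_mem_nhds hρ] with r hr
      simp only [hφ]
      exact ((hasDerivAt_id r).add ((Real.hasDerivAt_log hr.ne').const_mul (δ y))).add_const (b y)
    have hφ_deriv2 : HasDerivAt (fun r => 1 + δ y * r⁻¹) (δ y * -(ρ ^ 2)⁻¹) ρ :=
      ((hasDerivAt_inv hρ.ne').const_mul (δ y)).const_add 1
    have second := deriv_deriv_mul_cos
      (Filter.Eventually.of_forall fun r => hasDerivAt_const r (a y)) hφ_deriv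
      (hasDerivAt_const ρ 0) hφ_deriv2
    simp only [Psi]
    rw [second, Real.cos_three_mul, hδ y]
    field_simp
    ring
  · refine ⟨fun j y => match j with
        | 0 => deriv (deriv a) y - a y * deriv b y ^ 2
        | 1 => -(2 * a y * deriv δ y * deriv b y)
        | _ => -(a y * deriv δ y ^ 2),
      fun j y => match j with
        | 0 => -(2 * deriv a y * deriv b y + a y * deriv (deriv b) y)
        | 1 => -(2 * deriv a y * deriv δ y + a y * deriv (deriv δ) y)
        | _ => 0, ?_, ?_⟩
    · rintro (_ | _ | j) <;> constructor <;> fun_prop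
    · intro ρ _ y
      have hφ_deriv (z : ℝ) :
          HasDerivAt (fun z => φ ρ z) (deriv δ z * Real.log ρ + deriv b z) z := by
        simp only [hφ]
        exact (((hasDeriv smooth_δ z).mul_const (Real.log ρ)).const_add ρ).add (hasDeriv hb z)
      rw [deriv_deriv_mul_cos (Filter.Eventually.of_forall (hasDeriv ha))
        (Filter.Eventually.of_forall hφ_deriv) (hasDeriv ha' y)
        (((hasDeriv hδ' y).mul_const (Real.log ρ)).add (hasDeriv hb' y))]
      simp only [Finset.sum_range_succ, Finset.sum_range_zero]
      ring
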